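/- Relative entropy representation of the Sanov-type rate function (Lemma SanovT::RelEntropy, r = 1): Let Y be a Polish space, let {Q_{x,w,θ}}_{(x,w,θ)∈T^d×W×ℝ} ⊆ M₁(Y) be Feller continuous, and let {ν_x}_{x∈T^d} ⊆ M₁(ℝ) and {ζ_x}_{x∈T^d} ⊆ M₁(W) be Feller continuous; set Q_{x,w} := ∫_ℝ Q_{x,w,θ} ν_x(dθ) and L_{ν,ζ}(Γ) := sup_{f ∈ C_b(T^d×W×Y)} { ∫ f dΓ − ∫_{T^d} log( ∫_W ∫_Y e^{f(x,w,y)} Q_{x,w}(dy) ζ_x(dw) ) dx } for Γ ∈ M₁(T^d×W×Y). If Γ has Lebesgue T^d-marginal, i.e. Γ = dx ⊗ Γ_x ∈ M₁^L(T^d×W×Y) with Γ_x = Γ_{x,W}(dw) ⊗ Γ_{x,w}, then L_{ν,ζ}(Γ) = H( Γ | dx ⊗ ζ_x(dw) ⊗ Q_{x,w} ) = ∫_{T^d} H( Γ_x | ζ_x(dw) ⊗ Q_{x,w} ) dx = ∫_{T^d} ∫_W H( Γ_{x,w} | Q_{x,w} ) Γ_{x,W}(dw) dx + ∫_{T^d}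 H( Γ_{x,W} | ζ_x ) dx. If the T^d-marginal of Γ is not Lebesgue measure, then L_{ν,ζ}(Γ) = ∞. -/

import Mathlib

open MeasureTheory Filter Topology
open scoped ENNReal NNReal Classical

set_option synthInstance.maxSize 1000
set_option synthInstance.maxHeartbeats 1000000
set_option maxHeartbeats 1000000

noncomputable section

namespace PaperSanov

/-- The `d`-dimensional torus `T^d = ℝ^d/ℤ^d`, with its Haar (Lebesgue) probability
measure `volume`. -/
abbrev Td (d : ℕ) : Type := Fin d → UnitAddCircle

/-- The point `k/N` of the discrete torus `T^d_N = (ℤ/Nℤ)^d`, embedded in `T^d`. -/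
def gridPt {d N : ℕ} (k : Fin d → Fin N) : Td d :=
  fun i => ((((k i : ℕ) : ℝ) / (N : ℝ) : ℝ) : UnitAddCircle)

/-- `Q_{x,w} := ∫_ℝ Q_{x,w,θ} ν_x(dθ)`, the kernel obtained by averaging the parameter
`θ` over the distribution `ν_x`. -/
def Qavg {d m : ℕ} {W : Set (EuclideanSpace ℝ (Fin m))} {Y : Type*} [MeasurableSpace Y]
    (ν : Td d → ProbabilityMeasure ℝ) (Q : Td d × ↥W × ℝ → ProbabilityMeasure Y)
    (x : Td d) (w : ↥W) : Measure Y :=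
  (ν x : Measure ℝ).bind fun θ => (Q (x, w, θ) : Measure Y)


/-- The relative entropy `H(μ‖ν) = ∫ log (dμ/dν) dμ` if `μ ≪ ν` (and the
log-likelihood ratio is integrable, which for probability measures fails only when the
entropy is infinite), and `H(μ‖ν) = ∞` otherwise. -/
def relEnt {Z : Type*} [MeasurableSpace Z] (μ ν' : Measure Z) : ℝ≥0∞ :=
  if μ ≪ ν' ∧ Integrable (llr μ ν') μ then ENNReal.ofReal (∫ z, llr μ ν' z ∂μ) else ⊤

/-- The Sanov-type rate function `L_{ν,ζ}` (case `r = 1`), given by the variational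
formula over bounded continuous functions. -/
def LRate {d m : ℕ} {W : Set (EuclideanSpace ℝ (Fin m))} {Y : Type*}
    [TopologicalSpace Y] [MeasurableSpace Y]
    (ν : Td d → ProbabilityMeasure ℝ) (ζ : Td d → ProbabilityMeasure ↥W)
    (Q : Td d × ↥W × ℝ → ProbabilityMeasure Y)
    (Γ : Measure (Td d × ↥W × Y)) : EReal :=
  ⨆ f : BoundedContinuousFunction (Td d × ↥W × Y) ℝ,
    ((∫ z, f z ∂Γ -
      ∫ x, Real.log (∫ w, (∫ y, Real.exp (f (x, w, y)) ∂(Qavg ν Q x w))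
        ∂(ζ x : Measure ↥W)) ∂(volume : Measure (Td d)) : ℝ) : EReal)

/-- The reference measure `dx ⊗ ζ_x(dw) ⊗ Q_{x,w}(dy)` on `T^d × W × Y`. -/
def refMeas {d m : ℕ} {W : Set (EuclideanSpace ℝ (Fin m))} {Y : Type*} [MeasurableSpace Y]
    (ν : Td d → ProbabilityMeasure ℝ) (ζ : Td d → ProbabilityMeasure ↥W)
    (Q : Td d × ↥W × ℝ → ProbabilityMeasure Y) : Measure (Td d × ↥W × Y) :=
  (volume : Measure (Td d)).bind fun x =>
    (ζ x : Measure ↥W).bind fun w => (Qavg ν Q x w).map fun y => (x, w, y)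

/-- The measure `ζ_x(dw) ⊗ Q_{x,w}(dy)` on `W × Y`, for fixed `x ∈ T^d`. -/
def mixWY {d m : ℕ} {W : Set (EuclideanSpace ℝ (Fin m))} {Y : Type*} [MeasurableSpace Y]
    (ν : Td d → ProbabilityMeasure ℝ) (ζ : Td d → ProbabilityMeasure ↥W)
    (Q : Td d × ↥W × ℝ → ProbabilityMeasure Y) (x : Td d) : Measure (↥W × Y) :=
  (ζ x : Measure ↥W).bind fun w => (Qavg ν Q x w).map fun y => (w, y)

section Helpers
open InformationTheory ProbabilityTheory

lemma young {p g : ℝ} (hp : 0 ≤ p) : p * g - Real.exp g + 1 ≤ klFun p := by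
  rw [klFun_apply]
  rcases hp.eq_or_lt with rfl | hp
  · simp; exact (Real.exp_pos g).le
  · have h := Real.add_one_le_exp (g - Real.log p)
    rw [Real.exp_sub, Real.exp_log hp, le_div_iff₀ hp] at h
    nlinarith

lemma kl_upper {Z : Type*} [MeasurableSpace Z] (μ ν : Measure Z) [IsProbabilityMeasure μ]
    [IsProbabilityMeasure ν] (g : Z → ℝ) (hg : Measurable g) (M : ℝ) (hM : ∀ z, |g z| ≤ M) :
    ENNReal.ofReal (∫ z, g z ∂μ - ∫ z, Real.exp (g z) ∂ν + 1) ≤ klDiv μ ν := by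
  by_cases hfin : klDiv μ ν = ⊤
  · simp [hfin]
  obtain ⟨hac, hint⟩ := klDiv_ne_top_iff.1 hfin
  rw [← ENNReal.ofReal_toReal hfin]
  apply ENNReal.ofReal_le_ofReal
  rw [toReal_klDiv_eq_integral_klFun hac, ← integral_rnDeriv_smul hac]
  have hgi : Integrable g μ := Integrable.of_bound hg.aestronglyMeasurable M (ae_of_all _ hM)
  have h1 : Integrable (fun z => (μ.rnDeriv ν z).toReal • g z) ν :=
    (integrable_rnDeriv_smul_iff hac).2 hgi
  have h2 : Integrable (fun z => Real.exp (g z)) ν :=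
    Integrable.of_bound hg.exp.aestronglyMeasurable (Real.exp M) (ae_of_all _ fun z => by
      rw [Real.norm_eq_abs, Real.abs_exp]; exact Real.exp_le_exp.2 ((abs_le.1 (hM z)).2))
  have h3 : ∫ z, (1:ℝ) ∂ν = 1 := by simp
  have h4 : Integrable (fun z => (μ.rnDeriv ν z).toReal • g z - Real.exp (g z)) ν := h1.sub h2
  rw [← h3, ← integral_sub h1 h2, ← integral_add h4 (integrable_const _)]
  refine integral_mono ((h1.sub h2).add (integrable_const _)) ?_ ?_
  · exact (integrable_klFun_rnDeriv_iff hac).2 hint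
  · intro z
    exact young ENNReal.toReal_nonneg

/-- extend inequality from bounded continuous to bounded measurable functions -/
lemma ext_meas {Z : Type*} [TopologicalSpace Z] [PolishSpace Z] [MeasurableSpace Z] [BorelSpace Z]
    (μ ν : Measure Z) [IsProbabilityMeasure μ] [IsProbabilityMeasure ν] (c : ℝ)
    (h : ∀ f : BoundedContinuousFunction Z ℝ, ∫ z, f z ∂μ - ∫ z, Real.exp (f z) ∂ν + 1 ≤ c)
    (g : Z → ℝ) (hg : Measurable g) (M : ℝ) (hM : ∀ z, |g z| ≤ M) :
    ∫ z, g z ∂μ - ∫ z, Real.exp (g z) ∂ν + 1 ≤ c := by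
  let _ := TopologicalSpace.upgradeIsCompletelyMetrizable Z
  have hb : ∀ (ρ : Measure Z) [IsFiniteMeasure ρ], Integrable g ρ := fun ρ _ =>
    Integrable.of_bound hg.aestronglyMeasurable M (ae_of_all _ hM)
  apply le_of_forall_pos_le_add
  intro ε hε
  set δ := ε / (1 + Real.exp M) with hδ
  have hE := Real.exp_pos M
  have hδ0 : 0 < δ := by positivity
  obtain ⟨f0, hf0, hf0i⟩ := (hb (μ + ν)).exists_boundedContinuous_integral_sub_le hδ0
  have hM0 : -M ≤ M := by
    obtain ⟨z⟩ : Nonempty Z := μ.nonempty_of_neZero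
    have := abs_le.1 (hM z); linarith
  let cl : ℝ → ℝ := fun t => max (-M) (min M t)
  let f : BoundedContinuousFunction Z ℝ := BoundedContinuousFunction.ofNormedAddCommGroup
    (fun z => cl (f0 z)) (by fun_prop) M (fun z => by
      rw [Real.norm_eq_abs, abs_le]
      exact ⟨le_max_left _ _, max_le hM0 (min_le_left _ _)⟩)
  have hfM : ∀ z, |f z| ≤ M := fun z => by
      rw [abs_le]
      exact ⟨le_max_left _ _, max_le hM0 (min_le_left _ _)⟩
  have hcl : ∀ z, |g z - f z| ≤ |g z - f0 z| := by
    intro z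
    have h1 : g z = cl (g z) := by
      have := abs_le.1 (hM z)
      simp only [cl]
      rw [min_eq_right this.2, max_eq_right this.1]
    have h2 : f z = cl (f0 z) := rfl
    rw [h2]
    have : |cl (g z) - cl (f0 z)| ≤ |g z - f0 z| := by
      simp only [cl]
      calc _ ≤ |min M (g z) - min M (f0 z)| := by
            simpa [abs_sub_comm] using abs_max_sub_max_le_abs (min M (g z)) (min M (f0 z)) (-M) |> fun h => by simpa [max_comm] using h
        _ ≤ _ := by
            have := abs_min_sub_min_le_max M (g z) M (f0 z)
            simpa using this
    rwa [← h1] at this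
  have hexp : ∀ z, |Real.exp (g z) - Real.exp (f z)| ≤ Real.exp M * |g z - f z| := by
    have key : ∀ a b : ℝ, a ≤ b → b ≤ M → |Real.exp b - Real.exp a| ≤ Real.exp M * |b - a| := by
      intro a b hab hbM
      rw [abs_of_nonneg (sub_nonneg.2 (Real.exp_le_exp.2 hab)), abs_of_nonneg (sub_nonneg.2 hab)]
      have h1 := Real.add_one_le_exp (a - b)
      have h2 : Real.exp a = Real.exp b * Real.exp (a - b) := by rw [← Real.exp_add]; ring_nf
      have h3 := Real.exp_le_exp.2 hbM
      have h4 := Real.exp_pos b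
      calc Real.exp b - Real.exp a ≤ Real.exp b * (b - a) := by rw [h2]; nlinarith
        _ ≤ _ := mul_le_mul_of_nonneg_right h3 (sub_nonneg.2 hab)
    intro z
    rcases le_total (g z) (f z) with h' | h'
    · rw [abs_sub_comm, abs_sub_comm (g z)]
      exact key _ _ h' (abs_le.1 (hfM z)).2
    · exact key _ _ h' (abs_le.1 (hM z)).2
  have hfi : ∀ (ρ : Measure Z) [IsFiniteMeasure ρ], Integrable f ρ := fun ρ _ => f.integrable ρ
  have hei : ∀ k : Z → ℝ, Measurable k → (∀ z, |k z| ≤ M) → Integrable (fun z => Real.exp (k z)) ν :=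
    fun k hk hkM => Integrable.of_bound hk.exp.aestronglyMeasurable (Real.exp M)
      (ae_of_all _ fun z => by
        rw [Real.norm_eq_abs, Real.abs_exp]; exact Real.exp_le_exp.2 ((abs_le.1 (hkM z)).2))
  have hd0 : ∀ (ρ : Measure Z) [IsFiniteMeasure ρ], Integrable (fun z => |g z - f0 z|) ρ :=
    fun ρ _ => ((hb ρ).sub (f0.integrable ρ)).abs
  have hd1 : ∀ (ρ : Measure Z) [IsFiniteMeasure ρ], Integrable (fun z => |g z - f z|) ρ :=
    fun ρ _ => ((hb ρ).sub (f.integrable ρ)).abs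
  have hsum : ∫ z, |g z - f0 z| ∂μ + ∫ z, |g z - f0 z| ∂ν ≤ δ := by
    rw [← integral_add_measure (hd0 μ) (hd0 ν)]
    simpa using hf0
  have hν0 : 0 ≤ ∫ z, |g z - f0 z| ∂ν := integral_nonneg fun z => abs_nonneg _
  have hμ0 : 0 ≤ ∫ z, |g z - f0 z| ∂μ := integral_nonneg fun z => abs_nonneg _
  have e1 : ∫ z, g z ∂μ - ∫ z, f z ∂μ ≤ δ := by
    rw [← integral_sub (hb μ) (hfi μ)]
    calc _ ≤ ∫ z, |g z - f0 z| ∂μ := integral_mono ((hb μ).sub (hfi μ)) (hd0 μ)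
            fun z => (le_abs_self _).trans (hcl z)
      _ ≤ δ := by linarith
  have hgE := hei g hg hM
  have hfE := hei f f.continuous.measurable hfM
  have e2 : ∫ z, Real.exp (f z) ∂ν - ∫ z, Real.exp (g z) ∂ν ≤ Real.exp M * δ := by
    rw [← integral_sub hfE hgE]
    calc _ ≤ ∫ z, Real.exp M * |g z - f0 z| ∂ν := integral_mono (hfE.sub hgE) ((hd0 ν).const_mul _)
            fun z => (le_abs_self _).trans (by
              refine (abs_sub_comm _ _).trans_le ?_
              exact (hexp z).trans (mul_le_mul_of_nonneg_left (hcl z) hE.le))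
      _ = Real.exp M * ∫ z, |g z - f0 z| ∂ν := integral_const_mul _ _
      _ ≤ _ := mul_le_mul_of_nonneg_left (by linarith) hE.le
  have e3 : δ + Real.exp M * δ = ε := by rw [hδ]; field_simp
  have := h f
  linarith

lemma trunc_nonneg {p : ℝ} (hp : 0 ≤ p) (n : ℕ) :
    let g := max (-(n:ℝ)) (min n (if p = 0 then -(n:ℝ) else Real.log p))
    0 ≤ p * g - Real.exp g + 1 := by
  intro g
  have h1 : 0 ≤ Real.exp g * g - Real.exp g + 1 := by
    have := Real.add_one_le_exp (-g)
    have h2 : Real.exp g * Real.exp (-g) = 1 := by rw [← Real.exp_add]; simp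
    nlinarith [Real.exp_pos g]
  suffices Real.exp g * g ≤ p * g by linarith
  have hn : (0:ℝ) ≤ n := Nat.cast_nonneg n
  rcases hp.eq_or_lt with rfl | hp
  · have : g ≤ 0 := by
      simp only [g, if_true]
      apply max_le <;> [linarith; exact (min_le_right _ _).trans (by linarith)]
    nlinarith [Real.exp_pos g]
  · have hg : g = max (-(n:ℝ)) (min n (Real.log p)) := by simp [g, hp.ne']
    have hL := Real.exp_log hp
    rcases le_total (Real.log p) (-n) with h2 | h2
    · have hgn : g = -n := by rw [hg]; exact max_eq_left ((min_le_right _ _).trans h2)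
      apply mul_le_mul_of_nonpos_right _ (by linarith)
      rw [← hL]; exact Real.exp_le_exp.2 (by linarith)
    rcases le_total (Real.log p) n with h3 | h3
    · have hgn : g = Real.log p := by rw [hg, min_eq_right h3, max_eq_right h2]
      rw [hgn, hL]
    · have hgn : g = n := by rw [hg, min_eq_left h3, max_eq_right (by linarith)]
      apply mul_le_mul_of_nonneg_right _ (by linarith)
      rw [← hL]; exact Real.exp_le_exp.2 (by linarith)

lemma kl_lower {Z : Type*} [TopologicalSpace Z] [PolishSpace Z] [MeasurableSpace Z] [BorelSpace Z]
    (μ ν : Measure Z) [IsProbabilityMeasure μ] [IsProbabilityMeasure ν] (c : ℝ)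
    (h0 : ∀ f : BoundedContinuousFunction Z ℝ, ∫ z, f z ∂μ - ∫ z, Real.exp (f z) ∂ν + 1 ≤ c) :
    klDiv μ ν ≤ ENNReal.ofReal c := by
  have h := ext_meas μ ν c h0
  have hac : μ ≪ ν := by
    refine Measure.AbsolutelyContinuous.mk fun s hs hνs => ?_
    by_contra hne
    have hpos : 0 < μ.real s := by
      rw [measureReal_def]; exact ENNReal.toReal_pos hne (measure_ne_top _ _)
    have hc0 : 0 ≤ c := by simpa using h0 0
    set t := (c + 1) / μ.real s
    have ht : 0 ≤ t := by positivity
    have := h (s.indicator fun _ => t) (measurable_const.indicator hs) t (fun z => by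
      by_cases hz : z ∈ s <;> simp [hz, abs_of_nonneg ht, ht])
    rw [integral_indicator_const _ hs] at this
    have h2 : ∫ z, Real.exp (s.indicator (fun _ => t) z) ∂ν = ∫ z, (1:ℝ) ∂ν := by
      apply integral_congr_ae
      have : ∀ᵐ z ∂ν, z ∉ s := measure_eq_zero_iff_ae_notMem.1 hνs
      filter_upwards [this] with z hz
      simp [hz]
    rw [h2] at this
    have h3 : μ.real s * t = c + 1 := by simp only [t]; field_simp
    simp at this
    linarith
  rw [klDiv_eq_lintegral_klFun_of_ac hac]
  set p : Z → ℝ := fun z => (μ.rnDeriv ν z).toReal with hp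
  have hpm : Measurable p := (Measure.measurable_rnDeriv _ _).ennreal_toReal
  have hp0 : ∀ z, 0 ≤ p z := fun z => ENNReal.toReal_nonneg
  let g : ℕ → Z → ℝ := fun n z =>
    max (-(n:ℝ)) (min n (if p z = 0 then -(n:ℝ) else Real.log (p z)))
  have hgm : ∀ n, Measurable (g n) := fun n => by
    refine measurable_const.max (measurable_const.min ?_)
    exact Measurable.ite (hpm (measurableSet_singleton 0)) measurable_const hpm.log
  have hgb : ∀ n z, |g n z| ≤ n := fun n z => by
    have hn : (0:ℝ) ≤ n := Nat.cast_nonneg n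
    exact abs_le.2 ⟨le_max_left _ _, max_le (by linarith) (min_le_left _ _)⟩
  have hlim : ∀ z, Tendsto (fun n => ENNReal.ofReal (p z * g n z - Real.exp (g n z) + 1)) atTop
      (𝓝 (ENNReal.ofReal (klFun (p z)))) := by
    intro z
    apply ENNReal.tendsto_ofReal
    rcases (hp0 z).eq_or_lt with h0 | h0
    · simp only [g, ← h0]
      simp only [if_true, klFun_zero, zero_mul, zero_sub]
      have : ∀ n : ℕ, max (-(n:ℝ)) (min n (-(n:ℝ))) = -n := fun n => by
        have hn : (0:ℝ) ≤ n := Nat.cast_nonneg n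
        rw [min_eq_right (by linarith), max_self]
      simp only [this]
      have := Real.tendsto_exp_neg_atTop_nhds_zero.comp (tendsto_natCast_atTop_atTop (R := ℝ))
      simpa using (this.neg.add_const 1)
    · apply tendsto_const_nhds.congr'
      filter_upwards [eventually_ge_atTop ⌈|Real.log (p z)|⌉₊] with n hn
      have hn' : |Real.log (p z)| ≤ n := (Nat.le_ceil _).trans (by exact_mod_cast hn)
      have : g n z = Real.log (p z) := by
        simp only [g, h0.ne', if_false]
        rw [min_eq_right (abs_le.1 hn').2, max_eq_right (abs_le.1 hn').1]
      rw [this, Real.exp_log h0, klFun_apply]; ring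
  calc ∫⁻ z, ENNReal.ofReal (klFun (p z)) ∂ν
      = ∫⁻ z, liminf (fun n => ENNReal.ofReal (p z * g n z - Real.exp (g n z) + 1)) atTop ∂ν := by
        apply lintegral_congr; intro z; exact (hlim z).liminf_eq.symm
    _ ≤ liminf (fun n => ∫⁻ z, ENNReal.ofReal (p z * g n z - Real.exp (g n z) + 1) ∂ν) atTop :=
        lintegral_liminf_le fun n => by
          have := hgm n
          fun_prop
    _ ≤ ENNReal.ofReal c := by
        apply liminf_le_of_le
        · isBoundedDefault
        intro b hb
        obtain ⟨n, hn⟩ := hb.exists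
        refine hn.trans ?_
        have hgi : Integrable (g n) μ :=
          Integrable.of_bound (hgm n).aestronglyMeasurable n (ae_of_all _ (hgb n))
        have h1 : Integrable (fun z => p z • g n z) ν := (integrable_rnDeriv_smul_iff hac).2 hgi
        have h2 : Integrable (fun z => Real.exp (g n z)) ν :=
          Integrable.of_bound (hgm n).exp.aestronglyMeasurable (Real.exp n) (ae_of_all _ fun z => by
            rw [Real.norm_eq_abs, Real.abs_exp]; exact Real.exp_le_exp.2 ((abs_le.1 (hgb n z)).2))
        have h3 : ∫ z, (1:ℝ) ∂ν = 1 := by simp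
        have h4 : Integrable (fun z => p z • g n z - Real.exp (g n z)) ν := h1.sub h2
        have h5 : Integrable (fun z => p z * g n z - Real.exp (g n z) + 1) ν :=
          h4.add (integrable_const 1)
        rw [← ofReal_integral_eq_lintegral_ofReal h5
          (ae_of_all _ fun z => trunc_nonneg (hp0 z) n)]
        apply ENNReal.ofReal_le_ofReal
        have := h (g n) (hgm n) n (hgb n)
        rw [← integral_rnDeriv_smul hac, ← h3, ← integral_sub h1 h2,
          ← integral_add h4 (integrable_const _)] at this
        exact this

lemma klDiv_compProd_lintegral {α β : Type*} [MeasurableSpace α] [MeasurableSpace β]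
    [MeasurableSpace.CountableOrCountablyGenerated α β] (μ : Measure α) [IsProbabilityMeasure μ]
    (κ η : Kernel α β) [IsMarkovKernel κ] [IsMarkovKernel η] :
    klDiv (μ ⊗ₘ κ) (μ ⊗ₘ η) = ∫⁻ x, klDiv (κ x) (η x) ∂μ := by
  by_cases hac : μ ⊗ₘ κ ≪ μ ⊗ₘ η
  · have hac' := Measure.absolutelyContinuous_compProd_right_iff.1 hac
    rw [klDiv_eq_lintegral_klFun_of_ac hac]
    have hm : Measurable fun q : α × β => κ.rnDeriv η q.1 q.2 := Kernel.measurable_rnDeriv κ η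
    have e : μ ⊗ₘ κ = (μ ⊗ₘ η).withDensity (fun q => κ.rnDeriv η q.1 q.2) := by
      rw [← Measure.compProd_withDensity (Kernel.measurable_rnDeriv κ η)]
      apply Measure.compProd_congr
      filter_upwards [hac'] with x hx
      exact (Kernel.withDensity_rnDeriv_eq hx).symm
    have e2 : (μ ⊗ₘ κ).rnDeriv (μ ⊗ₘ η) =ᵐ[μ ⊗ₘ η] fun q => κ.rnDeriv η q.1 q.2 := by
      conv_lhs => rw [e]
      exact Measure.rnDeriv_withDensity _ hm
    have hm2 : Measurable fun q : α × β =>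
        ENNReal.ofReal (klFun (κ.rnDeriv η q.1 q.2).toReal) := by
      have := hm.ennreal_toReal
      exact (measurable_klFun.comp this).ennreal_ofReal
    calc _ = ∫⁻ q, ENNReal.ofReal (klFun (κ.rnDeriv η q.1 q.2).toReal) ∂(μ ⊗ₘ η) := by
          apply lintegral_congr_ae
          filter_upwards [e2] with q hq
          rw [hq]
      _ = ∫⁻ x, ∫⁻ y, ENNReal.ofReal (klFun (κ.rnDeriv η x y).toReal) ∂(η x) ∂μ :=
          Measure.lintegral_compProd hm2
      _ = _ := by
          apply lintegral_congr_ae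
          filter_upwards [hac'] with x hx
          rw [klDiv_eq_lintegral_klFun_of_ac hx]
          apply lintegral_congr_ae
          filter_upwards [Kernel.rnDeriv_eq_rnDeriv_measure (κ := κ) (η := η) (a := x)] with y hy
          rw [hy]
  · rw [klDiv_of_not_ac hac]
    rw [Measure.absolutelyContinuous_compProd_right_iff] at hac
    symm
    by_contra hne
    apply hac
    have hs := Kernel.measurableSet_absolutelyContinuous κ η
    rw [ae_iff]
    by_contra h0
    apply hne
    rw [eq_top_iff]
    calc (⊤ : ℝ≥0∞) = ⊤ * μ {x | ¬ κ x ≪ η x} := (ENNReal.top_mul h0).symm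
      _ = ∫⁻ x in {x | ¬ κ x ≪ η x}, ⊤ ∂μ := by rw [setLIntegral_const]
      _ ≤ ∫⁻ x in {x | ¬ κ x ≪ η x}, klDiv (κ x) (η x) ∂μ := by
          apply setLIntegral_mono' hs.compl
          intro x hx
          rw [klDiv_of_not_ac hx]
      _ ≤ _ := setLIntegral_le_lintegral _ _

lemma measurable_klDiv {α β : Type*} [MeasurableSpace α] [MeasurableSpace β]
    [MeasurableSpace.CountableOrCountablyGenerated α β]
    (κ η : Kernel α β) [IsMarkovKernel κ] [IsMarkovKernel η] :
    Measurable fun x => klDiv (κ x) (η x) := by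
  have hm : Measurable fun q : α × β => κ.rnDeriv η q.1 q.2 := Kernel.measurable_rnDeriv κ η
  have hm2 : Measurable fun q : α × β =>
      ENNReal.ofReal (klFun (κ.rnDeriv η q.1 q.2).toReal) := by
    have := hm.ennreal_toReal
    exact (measurable_klFun.comp this).ennreal_ofReal
  have : (fun x => klDiv (κ x) (η x)) = fun x => if κ x ≪ η x then
      ∫⁻ y, ENNReal.ofReal (klFun (κ.rnDeriv η x y).toReal) ∂(η x) else ⊤ := by
    funext x
    rw [klDiv_eq_lintegral_klFun]
    congr 1
    apply lintegral_congr_ae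
    filter_upwards [Kernel.rnDeriv_eq_rnDeriv_measure (κ := κ) (η := η) (a := x)] with y hy
    rw [hy]
  rw [this]
  exact Measurable.ite (Kernel.measurableSet_absolutelyContinuous κ η)
    (hm2.lintegral_kernel_prod_right') measurable_const

lemma exists_kernel {α β : Type*} [MeasurableSpace α] [MeasurableSpace β] [Nonempty β]
    (μ : Measure α) (f : α → ProbabilityMeasure β)
    (hf : AEMeasurable (fun x => (f x : Measure β)) μ) :
    ∃ κ : Kernel α β, IsMarkovKernel κ ∧ ∀ᵐ x ∂μ, (f x : Measure β) = κ x := by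
  obtain ⟨b⟩ := ‹Nonempty β›
  obtain ⟨g, hg, hgr, hfg⟩ := hf.exists_ae_eq_range_subset (t := {m | m Set.univ = 1})
    (ae_of_all _ fun x => measure_univ) ⟨Measure.dirac b, by simp⟩
  refine ⟨⟨g, hg⟩, ⟨fun x => ⟨hgr ⟨x, rfl⟩⟩⟩, hfg⟩

lemma compProd_eq_bind {α β : Type*} [MeasurableSpace α] [MeasurableSpace β]
    (μ : Measure α) [IsProbabilityMeasure μ] (κ : Kernel α β) [IsMarkovKernel κ] :
    μ ⊗ₘ κ = μ.bind fun x => (κ x).map fun z => (x, z) := by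
  have hm : Measurable fun x => (κ x).map fun z => (x, z) := by
    refine Measure.measurable_of_measurable_coe _ fun s hs => ?_
    have : (fun x => (κ x).map (fun z => (x, z)) s) = fun x => κ x (Prod.mk x ⁻¹' s) := by
      funext x
      rw [Measure.map_apply measurable_prodMk_left hs]
    rw [this]
    exact Kernel.measurable_kernel_prodMk_left hs
  ext s hs
  rw [Measure.compProd_apply hs, Measure.bind_apply hs hm.aemeasurable]
  apply lintegral_congr
  intro x
  rw [Measure.map_apply measurable_prodMk_left hs]

lemma disint {α β : Type*} [MeasurableSpace α] [MeasurableSpace β] [Nonempty β]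
    (μ : Measure α) [IsProbabilityMeasure μ] (f : α → ProbabilityMeasure β)
    (h0 : (μ.bind fun x => (f x : Measure β).map fun z => (x, z)) ≠ 0) :
    ∃ κ : Kernel α β, IsMarkovKernel κ ∧ (∀ᵐ x ∂μ, (f x : Measure β) = κ x) ∧
      (μ.bind fun x => (f x : Measure β).map fun z => (x, z)) = μ ⊗ₘ κ := by
  have hae : AEMeasurable (fun x => (f x : Measure β).map fun z => (x, z)) μ := by
    by_contra hc
    apply h0
    rw [Measure.bind, Measure.map_of_not_aemeasurable hc, Measure.join_zero]
  have hf : AEMeasurable (fun x => (f x : Measure β)) μ := by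
    have := (Measure.measurable_map (Prod.snd : α × β → β) measurable_snd).comp_aemeasurable hae
    convert this using 1
    funext x
    simp only [Function.comp]
    rw [Measure.map_map measurable_snd measurable_prodMk_left]
    exact Measure.map_id.symm
  obtain ⟨κ, hκ, hfk⟩ := exists_kernel μ f hf
  refine ⟨κ, hκ, hfk, ?_⟩
  rw [compProd_eq_bind]
  apply Measure.bind_congr_right
  filter_upwards [hfk] with x hx
  rw [hx]

lemma measurable_of_continuous {P Z : Type*} [TopologicalSpace P] [MeasurableSpace P]
    [OpensMeasurableSpace P] [TopologicalSpace Z] [PolishSpace Z] [MeasurableSpace Z] [BorelSpace Z]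
    (ρ : P → ProbabilityMeasure Z) (hρ : Continuous ρ) :
    Measurable fun p => (ρ p : Measure Z) := by
  let _ := TopologicalSpace.upgradeIsCompletelyMetrizable Z
  refine Measurable.measure_of_isPiSystem_of_isProbabilityMeasure
    ((BorelSpace.measurable_eq (α := Z)).trans borel_eq_generateFrom_isClosed) isPiSystem_isClosed ?_
  intro F hF
  have hδ : ∀ n : ℕ, (0:ℝ) < 1 / ((n:ℝ) + 1) := fun n => by positivity
  refine measurable_of_tendsto_metrizable (f := fun (n : ℕ) (p : P) =>
    ∫⁻ z, thickenedIndicator (hδ n) F z ∂(ρ p : Measure Z)) ?_ ?_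
  · intro n
    apply Continuous.measurable
    rw [continuous_iff_continuousAt]
    intro p
    exact ProbabilityMeasure.tendsto_iff_forall_lintegral_tendsto.1 hρ.continuousAt _
  · rw [tendsto_pi_nhds]
    intro p
    exact tendsto_lintegral_thickenedIndicator_of_isClosed _ hF hδ
      tendsto_one_div_add_atTop_nhds_zero_nat

lemma relEnt_eq_klDiv {Z : Type*} [MeasurableSpace Z] (μ ν : Measure Z) [IsProbabilityMeasure μ]
    [IsProbabilityMeasure ν] : relEnt μ ν = klDiv μ ν := by
  rw [relEnt, klDiv_def]
  simp

lemma chain_fixed {α β : Type*} [MeasurableSpace α] [MeasurableSpace β] [Nonempty β]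
    [MeasurableSpace.CountableOrCountablyGenerated α β]
    (μ : Measure α) [IsProbabilityMeasure μ] (f : α → ProbabilityMeasure β)
    (π : ProbabilityMeasure (α × β))
    (hπ : (π : Measure (α × β)) = μ.bind fun x => (f x : Measure β).map fun z => (x, z))
    (ζ : Measure α) [IsProbabilityMeasure ζ] (η : Kernel α β) [IsMarkovKernel η] :
    klDiv (π : Measure (α × β)) (ζ ⊗ₘ η)
      = (∫⁻ x, klDiv (f x : Measure β) (η x) ∂μ) + klDiv μ ζ ∧
    μ = (π : Measure (α × β)).map Prod.fst := by
  obtain ⟨κ, hκ, hfk, hb⟩ := disint μ f (by rw [← hπ]; exact IsProbabilityMeasure.ne_zero _)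
  rw [hb] at hπ
  rw [hπ]
  constructor
  · rw [klDiv_compProd_eq_add, klDiv_compProd_lintegral, add_comm]
    congr 1
    apply lintegral_congr_ae
    filter_upwards [hfk] with x hx
    rw [hx]
  · exact (Measure.fst_compProd μ κ).symm

section Rate
variable {X V Y : Type*} [TopologicalSpace X] [PolishSpace X] [MeasurableSpace X] [BorelSpace X]
  [TopologicalSpace V] [PolishSpace V] [MeasurableSpace V] [BorelSpace V]
  [TopologicalSpace Y] [PolishSpace Y] [MeasurableSpace Y] [BorelSpace Y]

def rate (μ : Measure X) (zK : Kernel X V) (qK : Kernel (X × V) Y) (Γ : Measure (X × V × Y)) :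
    EReal :=
  ⨆ f : BoundedContinuousFunction (X × V × Y) ℝ,
    ((∫ z, f z ∂Γ - ∫ x, Real.log (∫ w, (∫ y, Real.exp (f (x, w, y)) ∂(qK (x, w))) ∂(zK x)) ∂μ : ℝ)
      : EReal)

lemma rate_eq (μ : Measure X) [IsProbabilityMeasure μ] (zK : Kernel X V) [IsMarkovKernel zK]
    (qK : Kernel (X × V) Y) [IsMarkovKernel qK] (Γ : Measure (X × V × Y)) [IsProbabilityMeasure Γ]
    (hΓ : Γ.map Prod.fst = μ) :
    rate μ zK qK Γ = ((klDiv Γ (μ ⊗ₘ (zK ⊗ₖ qK)) : ℝ≥0∞) : EReal) := by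
  -- basic facts about the partition function
  have key : ∀ f : BoundedContinuousFunction (X × V × Y) ℝ, ∃ Z : X → ℝ,
      Measurable Z ∧ (∀ x, Real.exp (-‖f‖) ≤ Z x) ∧ (∀ x, Z x ≤ Real.exp ‖f‖) ∧
      (∀ x, ∫ w, (∫ y, Real.exp (f (x, w, y)) ∂(qK (x, w))) ∂(zK x) = Z x) ∧
      (∀ x, Z x = ∫ p, Real.exp (f (x, p)) ∂((zK ⊗ₖ qK) x)) := by
    intro f
    have hfm : Measurable f := f.continuous.measurable
    have hb : ∀ z, |f z| ≤ ‖f‖ := f.norm_coe_le_norm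
    have hint : ∀ x, Integrable (fun p => Real.exp (f (x, p))) ((zK ⊗ₖ qK) x) := fun x =>
      Integrable.of_bound (hfm.comp measurable_prodMk_left).exp.aestronglyMeasurable
        (Real.exp ‖f‖) (ae_of_all _ fun z => by
        rw [Real.norm_eq_abs, Real.abs_exp]; exact Real.exp_le_exp.2 (abs_le.1 (hb _)).2)
    refine ⟨fun x => ∫ p, Real.exp (f (x, p)) ∂((zK ⊗ₖ qK) x), ?_, ?_, ?_, ?_, fun x => rfl⟩
    · exact (StronglyMeasurable.integral_kernel_prod_right' (κ := zK ⊗ₖ qK)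
        (f := fun z => Real.exp (f z)) hfm.exp.stronglyMeasurable).measurable
    · intro x
      have : ∫ p, Real.exp (-‖f‖) ∂((zK ⊗ₖ qK) x) = Real.exp (-‖f‖) := by simp
      rw [← this]
      exact integral_mono (integrable_const _) (hint x) fun p =>
        Real.exp_le_exp.2 (abs_le.1 (hb _)).1
    · intro x
      have : ∫ p, Real.exp (‖f‖) ∂((zK ⊗ₖ qK) x) = Real.exp (‖f‖) := by simp
      rw [← this]
      exact integral_mono (hint x) (integrable_const _) fun p =>
        Real.exp_le_exp.2 (abs_le.1 (hb _)).2
    · intro x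
      exact (ProbabilityTheory.integral_compProd (hint x)).symm
  have hval : ∀ f : BoundedContinuousFunction (X × V × Y) ℝ,
      ∫ z, Real.exp (f z) ∂(μ ⊗ₘ (zK ⊗ₖ qK)) =
        ∫ x, ∫ p, Real.exp (f (x, p)) ∂((zK ⊗ₖ qK) x) ∂μ := by
    intro f
    apply Measure.integral_compProd
    exact Integrable.of_bound f.continuous.measurable.exp.aestronglyMeasurable
        (Real.exp ‖f‖) (ae_of_all _ fun z => by
        rw [Real.norm_eq_abs, Real.abs_exp]
        exact Real.exp_le_exp.2 (abs_le.1 (f.norm_coe_le_norm z)).2)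
  have hlog : ∀ (Z : X → ℝ) (B : ℝ), Measurable Z → (∀ x, Real.exp (-B) ≤ Z x) →
      (∀ x, Z x ≤ Real.exp B) → (∀ x, |Real.log (Z x)| ≤ B) := by
    intro Z B _ h1 h2 x
    have h0 : 0 < Z x := (Real.exp_pos _).trans_le (h1 x)
    rw [abs_le]
    exact ⟨(Real.le_log_iff_exp_le h0).2 (h1 x), (Real.log_le_iff_le_exp h0).2 (h2 x)⟩
  apply le_antisymm
  · refine iSup_le fun f => ?_
    obtain ⟨Z, hZm, hZ1, hZ2, hZ3, hZ4⟩ := key f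
    have hZl := hlog Z _ hZm hZ1 hZ2
    simp only [hZ3]
    have hfm : Measurable f := f.continuous.measurable
    have hgm : Measurable fun z : X × V × Y => f z - Real.log (Z z.1) :=
      hfm.sub (hZm.comp measurable_fst).log
    have hgb : ∀ z : X × V × Y, |f z - Real.log (Z z.1)| ≤ ‖f‖ + ‖f‖ := fun z =>
      (abs_sub _ _).trans (add_le_add (f.norm_coe_le_norm z) (hZl _))
    have h := kl_upper Γ (μ ⊗ₘ (zK ⊗ₖ qK)) (fun z => f z - Real.log (Z z.1)) hgm _ hgb
    have e1 : ∫ z, (f z - Real.log (Z z.1)) ∂Γ = ∫ z, f z ∂Γ - ∫ x, Real.log (Z x) ∂μ := by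
      rw [integral_sub (f.integrable Γ)]
      · congr 1
        rw [← hΓ, integral_map measurable_fst.aemeasurable hZm.log.aestronglyMeasurable]
      · exact Integrable.of_bound (hZm.comp measurable_fst).log.aestronglyMeasurable _
          (ae_of_all _ fun z => hZl _)
    have e2 : ∫ z, Real.exp (f z - Real.log (Z z.1)) ∂(μ ⊗ₘ (zK ⊗ₖ qK)) = 1 := by
      rw [Measure.integral_compProd]
      · have : ∀ x, ∫ p, Real.exp (f (x, p) - Real.log (Z x)) ∂((zK ⊗ₖ qK) x) = 1 := by
          intro x
          have h0 : 0 < Z x := (Real.exp_pos _).trans_le (hZ1 x)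
          simp only [Real.exp_sub, Real.exp_log h0]
          rw [integral_div, ← hZ4, div_self h0.ne']
        simp [this]
      · exact Integrable.of_bound hgm.exp.aestronglyMeasurable
          (Real.exp (‖f‖ + ‖f‖)) (ae_of_all _ fun z => by
          rw [Real.norm_eq_abs, Real.abs_exp]
          exact Real.exp_le_exp.2 (abs_le.1 (hgb z)).2)
    rw [e1, e2, sub_add_cancel] at h
    calc ((_ : ℝ) : EReal) ≤ ((ENNReal.ofReal _ : ℝ≥0∞) : EReal) := by
          rw [EReal.coe_ennreal_ofReal]
          exact EReal.coe_le_coe_iff.2 (le_max_left _ _)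
      _ ≤ _ := EReal.coe_ennreal_le_coe_ennreal_iff.2 h
  · have hnn : (0 : EReal) ≤ rate μ zK qK Γ := by
      refine le_iSup_of_le 0 ?_
      simp
    by_cases htop : rate μ zK qK Γ = ⊤
    · rw [htop]; exact le_top
    have hbot : rate μ zK qK Γ ≠ ⊥ := fun h => by rw [h] at hnn; simp at hnn
    have hc := EReal.coe_toReal htop hbot
    set c := (rate μ zK qK Γ).toReal
    rw [← hc] at hnn ⊢
    have hc0 : 0 ≤ c := by exact_mod_cast hnn
    have hle := kl_lower Γ (μ ⊗ₘ (zK ⊗ₖ qK)) c (fun f => by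
      obtain ⟨Z, hZm, hZ1, hZ2, hZ3, hZ4⟩ := key f
      have hZl := hlog Z _ hZm hZ1 hZ2
      have h1 : ((∫ z, f z ∂Γ - ∫ x, Real.log (Z x) ∂μ : ℝ) : EReal) ≤ (c : EReal) := by
        rw [hc]
        refine le_iSup_of_le f ?_
        simp only [hZ3]; exact le_rfl
      have h2 := EReal.coe_le_coe_iff.1 h1
      have h3 : ∫ x, Real.log (Z x) ∂μ ≤ ∫ x, (Z x - 1) ∂μ := by
        have hZi : Integrable Z μ := Integrable.of_bound hZm.aestronglyMeasurable (Real.exp ‖f‖)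
          (ae_of_all _ fun x => by
            rw [Real.norm_eq_abs, abs_of_nonneg ((Real.exp_pos _).le.trans (hZ1 x))]
            exact hZ2 x)
        have hli : Integrable (fun x => Real.log (Z x)) μ :=
          Integrable.of_bound hZm.log.aestronglyMeasurable _ (ae_of_all _ hZl)
        exact integral_mono hli (hZi.sub (integrable_const 1)) fun x =>
          Real.log_le_sub_one_of_pos ((Real.exp_pos _).trans_le (hZ1 x))
      have h4 : ∫ x, (Z x - 1) ∂μ = ∫ x, Z x ∂μ - 1 := by
        have hZi : Integrable Z μ := Integrable.of_bound hZm.aestronglyMeasurable (Real.exp ‖f‖)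
          (ae_of_all _ fun x => by
            rw [Real.norm_eq_abs, abs_of_nonneg ((Real.exp_pos _).le.trans (hZ1 x))]
            exact hZ2 x)
        rw [integral_sub hZi (integrable_const 1)]; simp
      rw [hval f]
      simp only [← hZ4]
      linarith)
    calc _ ≤ ((ENNReal.ofReal c : ℝ≥0∞) : EReal) := EReal.coe_ennreal_le_coe_ennreal_iff.2 hle
      _ = _ := by rw [EReal.coe_ennreal_ofReal, max_eq_left hc0]

lemma rate_top (μ : Measure X) [IsProbabilityMeasure μ] (zK : Kernel X V) [IsMarkovKernel zK]
    (qK : Kernel (X × V) Y) [IsMarkovKernel qK] (Γ : Measure (X × V × Y)) [IsProbabilityMeasure Γ]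
    (hΓ : Γ.map Prod.fst ≠ μ) : rate μ zK qK Γ = ⊤ := by
  have hex : ∃ g : BoundedContinuousFunction X ℝ, ∫ x, g x ∂(Γ.map Prod.fst) ≠ ∫ x, g x ∂μ := by
    by_contra hc
    push Not at hc
    let _ := TopologicalSpace.upgradeIsCompletelyMetrizable X
    have : IsProbabilityMeasure (Γ.map Prod.fst) :=
      Measure.isProbabilityMeasure_map measurable_fst.aemeasurable
    exact hΓ (ext_of_forall_integral_eq_of_IsFiniteMeasure hc)
  obtain ⟨g, hg⟩ := hex
  set a := ∫ x, g x ∂(Γ.map Prod.fst) - ∫ x, g x ∂μ with ha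
  have ha0 : a ≠ 0 := sub_ne_zero.2 hg
  have hle : ∀ r : ℝ, (r : EReal) ≤ rate μ zK qK Γ := by
    intro r
    refine le_iSup_of_le ((r / a) • g.compContinuous ⟨Prod.fst, continuous_fst⟩) ?_
    apply le_of_eq
    congr 1
    simp only [BoundedContinuousFunction.coe_smul, BoundedContinuousFunction.compContinuous_apply,
      ContinuousMap.coe_mk, smul_eq_mul, integral_const, probReal_univ, one_mul, Real.log_exp]
    rw [integral_const_mul, integral_const_mul, ← mul_sub]
    rw [integral_map measurable_fst.aemeasurable
      g.continuous.measurable.aestronglyMeasurable] at ha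
    rw [← ha]
    field_simp
  rw [EReal.eq_top_iff_forall_lt]
  intro r
  exact lt_of_lt_of_le (EReal.coe_lt_coe_iff.2 (lt_add_one r)) (hle (r + 1))

end Rate

end Helpers

/-- **Relative entropy representation of the Sanov-type rate function**
(Lemma `SanovT::RelEntropy`, case `r = 1`).  If `Γ` has Lebesgue `T^d`-marginal, with
disintegrations `Γ = dx ⊗ Γ_x` and `Γ_x = Γ_{x,W}(dw) ⊗ Γ_{x,w}`, then `L_{ν,ζ}(Γ)`
equals the relative entropy `H(Γ | dx ⊗ ζ_x(dw) ⊗ Q_{x,w})`, which can be further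
decomposed as iterated integrals of relative entropies of the disintegrations; if the
`T^d`-marginal of `Γ` is not Lebesgue measure, then `L_{ν,ζ}(Γ) = ∞`. -/
theorem sanov_rate_eq_relative_entropy
    {d m : ℕ} (W : Set (EuclideanSpace ℝ (Fin m))) (hW : IsClosed W)
    {Y : Type*} [TopologicalSpace Y] [PolishSpace Y] [MeasurableSpace Y] [BorelSpace Y]
    (ν : Td d → ProbabilityMeasure ℝ) (hν : Continuous ν)
    (ζ : Td d → ProbabilityMeasure ↥W) (hζ : Continuous ζ)
    (Q : Td d × ↥W × ℝ → ProbabilityMeasure Y) (hQ : Continuous Q)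
    (Γ : ProbabilityMeasure (Td d × ↥W × Y)) :
    (∀ (Γx : Td d → ProbabilityMeasure (↥W × Y))
       (ΓxW : Td d → ProbabilityMeasure ↥W)
       (Γxw : Td d → ↥W → ProbabilityMeasure Y),
       -- `Γ = dx ⊗ Γ_x` :
       ((Γ : Measure (Td d × ↥W × Y)) =
          (volume : Measure (Td d)).bind fun x =>
            (Γx x : Measure (↥W × Y)).map fun p => (x, p.1, p.2)) →
       -- `Γ_x = Γ_{x,W}(dw) ⊗ Γ_{x,w}` :
       (∀ x : Td d, (Γx x : Measure (↥W × Y)) =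
          (ΓxW x : Measure ↥W).bind fun w => (Γxw x w : Measure Y).map fun y => (w, y)) →
       (LRate ν ζ Q (Γ : Measure (Td d × ↥W × Y)) =
           ((relEnt (Γ : Measure (Td d × ↥W × Y)) (refMeas ν ζ Q) : ℝ≥0∞) : EReal) ∧
        LRate ν ζ Q (Γ : Measure (Td d × ↥W × Y)) =
           ((∫⁻ x, relEnt (Γx x : Measure (↥W × Y)) (mixWY ν ζ Q x)
               ∂(volume : Measure (Td d)) : ℝ≥0∞) : EReal) ∧
        LRate ν ζ Q (Γ : Measure (Td d × ↥W × Y)) =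
           (((∫⁻ x, (∫⁻ w, relEnt (Γxw x w : Measure Y) (Qavg ν Q x w)
                 ∂(ΓxW x : Measure ↥W)) ∂(volume : Measure (Td d))) +
             ∫⁻ x, relEnt (ΓxW x : Measure ↥W) (ζ x : Measure ↥W)
               ∂(volume : Measure (Td d)) : ℝ≥0∞) : EReal)))
    ∧
    ((Γ : Measure (Td d × ↥W × Y)).map Prod.fst ≠ (volume : Measure (Td d)) →
      LRate ν ζ Q (Γ : Measure (Td d × ↥W × Y)) = (⊤ : EReal)) := by
  classical
  have hPW : PolishSpace ↥W := hW.polishSpace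
  have hc1 : IsProbabilityMeasure (volume : Measure UnitAddCircle) :=
    ⟨by simpa using AddCircle.measure_univ (1 : ℝ)⟩
  have hcd : IsProbabilityMeasure (volume : Measure (Td d)) := ⟨by
    rw [volume_pi, Measure.pi_univ]; simp⟩
  -- kernels
  have hνm := measurable_of_continuous ν hν
  have hζm := measurable_of_continuous ζ hζ
  have hQm := measurable_of_continuous Q hQ
  let nK : ProbabilityTheory.Kernel (Td d) ℝ := ⟨fun x => (ν x : Measure ℝ), hνm⟩
  have : ProbabilityTheory.IsMarkovKernel nK :=
    ⟨fun x => (inferInstance : IsProbabilityMeasure (ν x : Measure ℝ))⟩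
  let zK : ProbabilityTheory.Kernel (Td d) ↥W := ⟨fun x => (ζ x : Measure ↥W), hζm⟩
  have : ProbabilityTheory.IsMarkovKernel zK :=
    ⟨fun x => (inferInstance : IsProbabilityMeasure (ζ x : Measure ↥W))⟩
  have hQs : ∀ (x : Td d) (w : ↥W), Measurable fun θ => (Q (x, w, θ) : Measure Y) := fun x w =>
    hQm.comp (measurable_const.prodMk (measurable_const.prodMk measurable_id))
  have hqm : Measurable fun p : Td d × ↥W => Qavg ν Q p.1 p.2 := by
    refine Measure.measurable_of_measurable_coe _ fun s hs => ?_
    let nK' : ProbabilityTheory.Kernel (Td d × ↥W) ℝ := nK.comap Prod.fst measurable_fst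
    have e : (fun p : Td d × ↥W => Qavg ν Q p.1 p.2 s) = fun p : Td d × ↥W =>
        ∫⁻ θ, (Q (p.1, p.2, θ) : Measure Y) s ∂(nK' p) := by
      funext p
      rw [Qavg, Measure.bind_apply hs (hQs _ _).aemeasurable]
      rfl
    rw [e]
    have hm : Measurable fun q : (Td d × ↥W) × ℝ => (Q (q.1.1, q.1.2, q.2) : Measure Y) s :=
      (Measure.measurable_coe hs).comp (hQm.comp (by fun_prop))
    exact hm.lintegral_kernel_prod_right' (κ := nK')
  have hqp : ∀ x w, IsProbabilityMeasure (Qavg ν Q x w) := fun x w => ⟨by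
    rw [Qavg, Measure.bind_apply MeasurableSet.univ (hQs _ _).aemeasurable]
    simp⟩
  let qK : ProbabilityTheory.Kernel (Td d × ↥W) Y := ⟨fun p => Qavg ν Q p.1 p.2, hqm⟩
  have : ProbabilityTheory.IsMarkovKernel qK := ⟨fun p => hqp p.1 p.2⟩
  have : Nonempty Y := (Q (0, ((ζ 0 : Measure ↥W).nonempty_of_neZero).some, 0)
    : Measure Y).nonempty_of_neZero
  have : Nonempty ↥W := (ζ 0 : Measure ↥W).nonempty_of_neZero
  have hLR : LRate ν ζ Q (Γ : Measure (Td d × ↥W × Y)) = rate volume zK qK Γ := rfl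
  let rK : Td d → ProbabilityTheory.Kernel ↥W Y := fun x => qK.sectR x
  have : ∀ x, ProbabilityTheory.IsMarkovKernel (rK x) := fun x => inferInstance
  have hmix1 : ∀ x, mixWY ν ζ Q x = (ζ x : Measure ↥W).compProd (rK x) := fun x => by
    rw [compProd_eq_bind]; rfl
  have hmix : ∀ x, mixWY ν ζ Q x = (zK.compProd qK) x := fun x => by
    rw [hmix1, ProbabilityTheory.Kernel.compProd_apply_eq_compProd_sectR]
    rfl
  have href : refMeas ν ζ Q = (volume : Measure (Td d)).compProd (zK.compProd qK) := by
    rw [compProd_eq_bind, refMeas]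
    congr 1
    funext x
    rw [← hmix]
    have hm : Measurable fun w => (Qavg ν Q x w).map fun y => (w, y) := by
      refine Measure.measurable_of_measurable_coe _ fun s hs => ?_
      have : (fun w => (Qavg ν Q x w).map (fun y => (w, y)) s)
          = fun w => rK x w (Prod.mk w ⁻¹' s) := by
        funext w
        rw [Measure.map_apply measurable_prodMk_left hs]
        rfl
      rw [this]
      exact ProbabilityTheory.Kernel.measurable_kernel_prodMk_left hs
    have hpx : Measurable fun p : ↥W × Y => (x, p) := measurable_prodMk_left
    have hm2 : Measurable fun w => (Qavg ν Q x w).map fun y => (x, w, y) := by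
      have := (Measure.measurable_map _ hpx).comp hm
      convert this using 1
      funext w
      simp only [Function.comp]
      rw [Measure.map_map hpx measurable_prodMk_left]
      rfl
    ext s hs
    rw [Measure.map_apply hpx hs, mixWY, Measure.bind_apply hs hm2.aemeasurable,
      Measure.bind_apply (hpx hs) hm.aemeasurable]
    apply lintegral_congr
    intro w
    have hh : Measurable fun y : Y => (x, w, y) := hpx.comp measurable_prodMk_left
    rw [Measure.map_apply hh hs, Measure.map_apply measurable_prodMk_left (hpx hs)]
    rfl
  constructor
  · intro Γx ΓxW Γxw hΓ hΓx
    obtain ⟨κ, hκ, hκe, hκb⟩ := disint (volume : Measure (Td d)) Γx (by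
      rw [← hΓ]; exact IsProbabilityMeasure.ne_zero _)
    have hΓ' : (Γ : Measure (Td d × ↥W × Y)) = (volume : Measure (Td d)).compProd κ :=
      hΓ.trans hκb
    have hmarg : (Γ : Measure (Td d × ↥W × Y)).map Prod.fst = volume := by
      rw [hΓ']; exact Measure.fst_compProd _ _
    have hmain : LRate ν ζ Q (Γ : Measure (Td d × ↥W × Y)) = ((InformationTheory.klDiv
        (Γ : Measure (Td d × ↥W × Y)) ((volume : Measure (Td d)).compProd (zK.compProd qK))
        : ℝ≥0∞) : EReal) := by
      rw [hLR]; exact rate_eq _ zK qK _ hmarg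
    have h2 : InformationTheory.klDiv
        (Γ : Measure (Td d × ↥W × Y)) ((volume : Measure (Td d)).compProd (zK.compProd qK))
        = ∫⁻ x, relEnt (Γx x : Measure (↥W × Y)) (mixWY ν ζ Q x) ∂(volume : Measure (Td d)) := by
      rw [hΓ', klDiv_compProd_lintegral]
      apply lintegral_congr_ae
      filter_upwards [hκe] with x hx
      rw [hmix, relEnt_eq_klDiv, hx]
    refine ⟨?_, ?_, ?_⟩
    · rw [hmain, href, relEnt_eq_klDiv]
    · rw [hmain, h2]
    · rw [hmain, h2]
      congr 1
      have hch := fun x => chain_fixed (ΓxW x : Measure ↥W) (Γxw x) (Γx x) (hΓx x)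
        (ζ x : Measure ↥W) (rK x)
      rw [← lintegral_add_right']
      · apply lintegral_congr
        intro x
        rw [hmix1, relEnt_eq_klDiv, (hch x).1, relEnt_eq_klDiv]
        congr 1
        apply lintegral_congr
        intro w
        have := hqp x w
        rw [relEnt_eq_klDiv]
        rfl
      · have : ProbabilityTheory.IsMarkovKernel κ.fst := inferInstance
        refine ⟨_, measurable_klDiv κ.fst zK, ?_⟩
        filter_upwards [hκe] with x hx
        rw [relEnt_eq_klDiv, (hch x).2, hx, ProbabilityTheory.Kernel.fst_apply]
        rfl
  · intro hne
    rw [hLR]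
    exact rate_top _ zK qK _ hne

end PaperSanov
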